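/- There are no positive integers x, y, z such that x^5 + y^5 = z^5. -/

import Mathlib

namespace FLT5

abbrev R := QuadraticAlgebra ℤ 1 1

open QuadraticAlgebra

lemma nrm (x : R) : norm x = x.re ^ 2 + x.re * x.im - x.im ^ 2 := by
  rw [norm_def]; ring

lemma int_zero {c d : ℤ} (h : c ^ 2 + c * d - d ^ 2 = 0) : c = 0 ∧ d = 0 := by
  have h2 : (2 * c + d) ^ 2 = d ^ 2 * 5 := by linear_combination 4 * h
  have hdvd : d ∣ 2 * c + d := (Int.pow_dvd_pow_iff (by norm_num : 2 ≠ 0)).1 ⟨5, h2⟩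
  obtain ⟨k, hk⟩ := hdvd
  rw [hk, mul_pow] at h2
  by_cases hd : d = 0
  · subst hd
    simp at hk
    exact ⟨by omega, rfl⟩
  · exfalso
    have h5 : k ^ 2 = 5 := mul_left_cancel₀ (pow_ne_zero 2 hd) h2
    have h3 : k < 3 := by nlinarith
    have h4 : -3 < k := by nlinarith
    interval_cases k <;> omega

lemma nrm_zero {x : R} (h : norm x = 0) : x = 0 := by
  rw [nrm] at h
  obtain ⟨h1, h2⟩ := int_zero h
  ext <;> simp [h1, h2]

instance : NoZeroDivisors R where
  eq_zero_or_eq_zero_of_mul_eq_zero := by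
    intro a b h
    have : norm a * norm b = 0 := by rw [← map_mul, h]; simp
    rcases mul_eq_zero.1 this with h | h
    · exact Or.inl (nrm_zero h)
    · exact Or.inr (nrm_zero h)

instance : IsDomain R := NoZeroDivisors.to_isDomain R

lemma near (p n : ℤ) (hn : n ≠ 0) : ∃ u, (2 * (p - u * n)) ^ 2 ≤ n ^ 2 := by
  have h1 := Int.emod_nonneg p hn
  have h2 := Int.emod_lt_abs p hn
  have h3 := Int.emod_add_mul_ediv p n
  set q := p / n
  set r := p % n
  have hp : p = r + n * q := h3.symm
  rcases le_or_gt (2 * r) |n| with h | h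
  · refine ⟨q, ?_⟩
    rw [← sq_abs n]
    have : p - q * n = r := by rw [hp]; ring
    rw [this]; nlinarith
  · rcases abs_cases n with ⟨ha, _⟩ | ⟨ha, _⟩
    · refine ⟨q + 1, ?_⟩
      have : p - (q + 1) * n = r - n := by rw [hp]; ring
      rw [this]; rw [ha] at h h2; nlinarith
    · refine ⟨q - 1, ?_⟩
      have : p - (q - 1) * n = r + n := by rw [hp]; ring
      rw [this]; rw [ha] at h h2; nlinarith

lemma exists_quot (x y : R) (hy : y ≠ 0) : ∃ q : R, (norm (x - y * q)).natAbs < (norm y).natAbs := by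
  have hn : norm y ≠ 0 := fun h => hy (nrm_zero h)
  obtain ⟨u, hu⟩ := near (x * star y).re (norm y) hn
  obtain ⟨v, hv⟩ := near (x * star y).im (norm y) hn
  refine ⟨⟨u, v⟩, ?_⟩
  have key : norm (x - y * ⟨u, v⟩) * norm y = ((x * star y).re - u * norm y) ^ 2 +
      ((x * star y).re - u * norm y) * ((x * star y).im - v * norm y) -
      ((x * star y).im - v * norm y) ^ 2 := by
    simp only [nrm, re_mul, im_mul, re_sub, im_sub, re_star, im_star]
    ring
  set P := (x * star y).re - u * norm y
  set Q := (x * star y).im - v * norm y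
  set n := norm y
  set m := norm (x - y * ⟨u, v⟩)
  rw [Int.natAbs_lt_iff_sq_lt]
  have hn2 : 0 < n ^ 2 := by positivity
  have hb1 : m * n < n ^ 2 := by rw [key]; nlinarith [sq_nonneg (P - Q), sq_nonneg (P + Q)]
  have hb2 : -(n ^ 2) < m * n := by rw [key]; nlinarith [sq_nonneg (P - Q), sq_nonneg (P + Q)]
  have : (m * n) ^ 2 < (n ^ 2) ^ 2 := sq_lt_sq' hb2 hb1
  have h3 : m ^ 2 * n ^ 2 < n ^ 2 * n ^ 2 := by linarith [mul_pow m n 2, sq (n ^ 2)]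
  exact lt_of_mul_lt_mul_right h3 hn2.le

open Classical in
noncomputable instance : EuclideanDomain R where
  quotient x y := if h : y = 0 then 0 else (exists_quot x y h).choose
  quotient_zero := by simp
  remainder x y := x - y * (if h : y = 0 then 0 else (exists_quot x y h).choose)
  quotient_mul_add_remainder_eq := by intro a b; ring
  r x y := (norm x).natAbs < (norm y).natAbs
  r_wellFounded := (measure (fun x : R => (norm x).natAbs)).wf
  remainder_lt := by
    intro a b hb
    simp only [hb, dif_neg, not_false_eq_true]
    exact (exists_quot a b hb).choose_spec
  mul_left_not_lt := by
    intro a b hb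
    rw [map_mul, Int.natAbs_mul, not_lt]
    have : norm b ≠ 0 := fun h => hb (nrm_zero h)
    exact Nat.le_mul_of_pos_right _ (by positivity)

/-- Golden ratio. -/
def phi : R := ⟨0, 1⟩

lemma unit_nonneg : ∀ s : ℕ, ∀ c d : ℤ, 0 ≤ c → 0 ≤ d → c + d ≤ s →
    (c ^ 2 + c * d - d ^ 2 = 1 ∨ c ^ 2 + c * d - d ^ 2 = -1) →
    ∃ n : ℕ, (⟨c, d⟩ : R) = phi ^ n := by
  intro s
  induction s with
  | zero =>
    intro c d hc hd hs h
    have : c = 0 := by push_cast at hs; omega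
    have : d = 0 := by push_cast at hs; omega
    subst c d
    norm_num at h
  | succ s ih =>
    intro c d hc hd hs h
    push_cast at hs
    rcases hc.eq_or_lt with rfl | hc
    · refine ⟨1, ?_⟩
      have : d = 1 := by rcases h with h | h <;> nlinarith
      subst this; rw [pow_one]; rfl
    rcases lt_or_ge d c with hdc | hdc
    · refine ⟨0, ?_⟩
      have h1 : c ^ 2 + c * d - d ^ 2 ≥ c ^ 2 + d := by nlinarith
      have : c = 1 := by rcases h with h | h <;> nlinarith
      have : d = 0 := by omega
      subst c d; rw [pow_zero]; rfl
    · obtain ⟨n, hn⟩ := ih (d - c) c (by omega) hc.le (by omega) (by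
        rcases h with h | h
        · right; linear_combination -h
        · left; linear_combination -h)
      refine ⟨n + 1, ?_⟩
      rw [pow_succ, ← hn]
      ext <;> simp [phi]

/-- The unit is a small power of the golden ratio times a fifth power. -/
def Good (u : R) : Prop := ∃ k : ℕ, k < 5 ∧ ∃ v : R, u = phi ^ k * v ^ 5

lemma good_pow (n : ℕ) (v : R) : Good (phi ^ n * v ^ 5) := by
  refine ⟨n % 5, Nat.mod_lt _ (by norm_num), phi ^ (n / 5) * v, ?_⟩
  conv_lhs => rw [← Nat.mod_add_div n 5]
  ring

lemma good_neg {u : R} (h : Good u) : Good (-u) := by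
  obtain ⟨k, hk, v, rfl⟩ := h
  exact ⟨k, hk, -v, by ring⟩

lemma good_neg' {u : R} (h : Good (-u)) : Good u := by simpa using good_neg h

lemma good_conj (n : ℕ) : Good (star (phi ^ n)) := by
  have h1 : star phi = phi ^ 4 * (star phi) ^ 5 := by
    have : phi * star phi = -1 := by ext <;> simp [phi]
    calc star phi = (-1) ^ 4 * star phi := by ring
      _ = (phi * star phi) ^ 4 * star phi := by rw [this]
      _ = _ := by ring
  rw [star_pow, h1, mul_pow, ← pow_mul, ← pow_mul, mul_comm 5 n, pow_mul _ n 5]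
  exact good_pow _ _

lemma unit_aux (c d : ℤ) (hc : 0 ≤ c)
    (h : c ^ 2 + c * d - d ^ 2 = 1 ∨ c ^ 2 + c * d - d ^ 2 = -1) : Good ⟨c, d⟩ := by
  rcases le_or_gt 0 d with hd | hd
  · obtain ⟨n, hn⟩ := unit_nonneg (c + d).toNat c d hc hd (by omega) h
    rw [hn]; simpa using good_pow n 1
  · rcases le_or_gt 0 (c + d) with hcd | hcd
    · obtain ⟨n, hn⟩ := unit_nonneg c.toNat (c + d) (-d) hcd (by omega) (by omega) (by
        rcases h with h | h
        · left; linear_combination h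
        · right; linear_combination h)
      have : (⟨c, d⟩ : R) = star (phi ^ n) := by rw [← hn]; ext <;> simp
      rw [this]; exact good_conj n
    · rcases hc.eq_or_lt with rfl | hc
      · have : d = -1 := by rcases h with h | h <;> nlinarith
        subst this
        exact ⟨1, by norm_num, -1, by ext <;> simp [phi, pow_succ]⟩
      · exfalso
        rcases h with h | h <;> nlinarith

lemma unit_good {u : R} (hu : IsUnit u) : Good u := by
  rw [isUnit_iff_norm_isUnit, Int.isUnit_iff, nrm] at hu
  rcases le_or_gt 0 u.re with h | h
  · exact unit_aux u.re u.im h hu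
  · apply good_neg'
    exact unit_aux (-u.re) (-u.im) (by omega) (by
      rcases hu with h | h
      · left; linear_combination h
      · right; linear_combination h)

lemma five_re (a : R) : ∃ C, a ^ 5 = ⟨C, 5 * (a.im * (norm a ^ 2 + 5 * norm a * a.im ^ 2 + 5 * a.im ^ 4))⟩ := by
  refine ⟨(a ^ 5).re, ?_⟩
  ext
  · rfl
  · simp only [pow_succ, pow_zero, one_mul, re_mul, im_mul, nrm]
    ring

lemma key {N e m : ℤ} (h : N ^ 2 + 5 * N * e + 5 * e ^ 2 = m ^ 5) (hN : ¬ (5 : ℤ) ∣ N)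
    (he : (5 : ℤ) ∣ e) (hc : IsCoprime N e) :
    ∃ c d : ℤ, c ^ 2 + c * d - d ^ 2 = m ∧
      e = 5 * (d * (m ^ 2 + 5 * m * d ^ 2 + 5 * d ^ 4)) := by
  have h5 : Prime (5 : ℤ) := by norm_num
  have hcop : IsCoprime (m ^ 5) (5 * e ^ 2) := by
    rw [← h]
    have h1 : IsCoprime (N ^ 2 + 5 * N * e + 5 * e ^ 2) e := by
      have : N ^ 2 + 5 * N * e + 5 * e ^ 2 = N ^ 2 + e * (5 * N + 5 * e) := by ring
      rw [this]
      exact (hc.pow_left (m := 2)).add_mul_left_left _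
    have h2 : IsCoprime (N ^ 2 + 5 * N * e + 5 * e ^ 2) 5 := by
      have : N ^ 2 + 5 * N * e + 5 * e ^ 2 = N ^ 2 + 5 * (N * e + e ^ 2) := by ring
      rw [this]
      have : IsCoprime N 5 := ((Prime.coprime_iff_not_dvd h5).2 hN).symm
      exact (this.pow_left (m := 2)).add_mul_left_left _
    exact h2.mul_right h1.pow_right
  set β : R := ⟨N + 2 * e, e⟩ with hβ
  have hnb : norm β = m ^ 5 := by rw [nrm, ← h]; simp only [hβ]; ring
  have hprod : β * star β = (m : R) ^ 5 := by
    have := algebraMap_norm_eq_mul_star β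
    rw [hnb] at this
    rw [← this]; simp
  have hcb : IsCoprime β (star β) := by
    obtain ⟨u, v, huv⟩ := hcop
    refine ⟨u * star β + v * (β - star β), - v * (β - star β), ?_⟩
    have h3 : (β - star β) ^ 2 = ((5 * e ^ 2 : ℤ) : R) := by
      ext <;> simp [hβ, pow_succ] <;> ring
    have h4 : (1 : R) = ((u * m ^ 5 + v * (5 * e ^ 2) : ℤ) : R) := by rw [huv]; simp
    rw [h4, Int.cast_add, Int.cast_mul, Int.cast_mul, ← h3]
    push_cast
    rw [← hprod]; ring
  obtain ⟨a, u, hu⟩ := exists_associated_pow_of_mul_eq_pow' hcb hprod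
  obtain ⟨k, hk, v, hv⟩ := unit_good u.isUnit
  have hb : β = phi ^ k * (a * v) ^ 5 := by rw [← hu, hv]; ring
  obtain ⟨C, hC⟩ := five_re (a * v)
  have hk0 : k = 0 := by
    by_contra hk0
    have h6 : (5 : ℤ) ∣ C := by
      rw [hC] at hb
      have him := congrArg QuadraticAlgebra.im hb
      simp only [hβ] at him
      generalize (a * v).im * _ = D at him
      obtain ⟨e', rfl⟩ := he
      interval_cases k
      · omega
      all_goals simp [phi, pow_succ] at him; omega
    have h7 : (5 : ℤ) ∣ m ^ 5 := by
      rw [← hnb, hb, hC, map_mul]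
      apply Dvd.dvd.mul_left
      rw [nrm]
      obtain ⟨C', rfl⟩ := h6
      generalize (a * v).im * _ = D
      exact ⟨5 * (C' ^ 2 + C' * D - D ^ 2), by ring⟩
    have h8 : IsCoprime (m ^ 5) 5 := hcop.of_mul_right_left
    exact h5.not_isUnit (h8.isUnit_of_dvd' h7 dvd_rfl)
  subst hk0
  rw [pow_zero, one_mul] at hb
  have hm : norm (a * v) = m := by
    have : norm (a * v) ^ 5 = m ^ 5 := by rw [← map_pow, ← hb, hnb]
    exact (Odd.strictMono_pow (by decide : Odd 5)).injective this
  refine ⟨(a * v).re, (a * v).im, by rw [← nrm, hm], ?_⟩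
  rw [hC, hm] at hb
  exact congrArg QuadraticAlgebra.im hb

/-- Splitting off: used twice. -/
lemma split {d Q z : ℤ} {k : ℕ} (h : d * Q = 5 ^ k * z ^ 5) (h5 : IsCoprime 5 Q)
    (hc : IsCoprime d Q) : ∃ w m, d = 5 ^ k * w ^ 5 ∧ Q = m ^ 5 := by
  have : (5 : ℤ) ^ k ∣ d := (h5.pow_left (m := k)).dvd_of_dvd_mul_right ⟨_, h⟩
  obtain ⟨d1, rfl⟩ := this
  have h2 : d1 * Q = z ^ 5 := by
    apply mul_left_cancel₀ (pow_ne_zero k (by norm_num : (5 : ℤ) ≠ 0))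
    rw [← h]; ring
  obtain ⟨⟨w, hw⟩, m, hm⟩ := Int.eq_pow_of_mul_eq_pow_odd hc.of_mul_left_right (by decide) h2
  exact ⟨w, m, by rw [hw], hm⟩

lemma Qcop {N e : ℤ} (hN : ¬ (5 : ℤ) ∣ N) (hc : IsCoprime N e) :
    IsCoprime 5 (N ^ 2 + 5 * N * e + 5 * e ^ 2) ∧ IsCoprime e (N ^ 2 + 5 * N * e + 5 * e ^ 2) := by
  have h5 : Prime (5 : ℤ) := by norm_num
  constructor
  · have : N ^ 2 + 5 * N * e + 5 * e ^ 2 = N ^ 2 + 5 * (N * e + e ^ 2) := by ring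
    rw [this]
    have : IsCoprime 5 N := ((Prime.coprime_iff_not_dvd h5).2 hN)
    exact (this.pow_right (n := 2)).add_mul_left_right _
  · have : N ^ 2 + 5 * N * e + 5 * e ^ 2 = N ^ 2 + e * (5 * N + 5 * e) := by ring
    rw [this]
    exact (hc.symm.pow_right (n := 2)).add_mul_left_right _

lemma descent : ∀ B : ℕ, ∀ (N e m s : ℤ) (k : ℕ), e.natAbs ≤ B → e ≠ 0 → e = 5 ^ (k + 2) * s ^ 5 →
    N ^ 2 + 5 * N * e + 5 * e ^ 2 = m ^ 5 → ¬ (5 : ℤ) ∣ N → IsCoprime N e → False := by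
  intro B
  induction B with
  | zero => intro N e m s k h1 h2; omega
  | succ B ih =>
    intro N e m s k hB he0 hes hm hN hc
    have h5 : Prime (5 : ℤ) := by norm_num
    have he5 : (5 : ℤ) ∣ e := by rw [hes]; exact ⟨5 ^ (k + 1) * s ^ 5, by ring⟩
    obtain ⟨c, d, hcd, hed⟩ := key hm hN he5 hc
    obtain ⟨hq1, hq2⟩ := Qcop hN hc
    rw [hm] at hq1 hq2
    have hm5 : ¬ (5 : ℤ) ∣ m := (Prime.coprime_iff_not_dvd h5).1
      ((IsCoprime.pow_right_iff (by norm_num)).1 hq1)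
    have hme : IsCoprime m e := ((IsCoprime.pow_right_iff (by norm_num)).1 hq2).symm
    have hmd : IsCoprime m d := hme.of_isCoprime_of_dvd_right ⟨5 * (m ^ 2 + 5 * m * d ^ 2 + 5 * d ^ 4), by rw [hed]; ring⟩
    have hmd2 : IsCoprime m (d ^ 2) := hmd.pow_right
    obtain ⟨hp1, hp2⟩ := Qcop hm5 hmd2
    have hQ : m ^ 2 + 5 * m * d ^ 2 + 5 * (d ^ 2) ^ 2 = m ^ 2 + 5 * m * d ^ 2 + 5 * d ^ 4 := by ring
    rw [hQ] at hp1 hp2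
    have hp3 := (IsCoprime.pow_left_iff (by norm_num)).1 hp2
    obtain ⟨w, m', hw, hm'⟩ := split (k := k + 1) (z := s)
      (d := d) (Q := m ^ 2 + 5 * m * d ^ 2 + 5 * d ^ 4) (by
        have : (5 : ℤ) * (d * (m ^ 2 + 5 * m * d ^ 2 + 5 * d ^ 4)) = 5 * (5 ^ (k + 1) * s ^ 5) := by
          rw [← hed, hes]; ring
        linarith) hp1 hp3
    have hd0 : d ≠ 0 := by rintro rfl; apply he0; rw [hed]; ring
    refine ih m (d ^ 2) m' (w ^ 2) (2 * k) ?_ (pow_ne_zero 2 hd0) (by rw [hw]; ring)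
      (by rw [hQ, hm']) hm5 hmd2
    have hd5 : (5 : ℤ) ∣ d := by rw [hw]; exact ⟨5 ^ k * w ^ 5, by ring⟩
    have hQ2 : 16 * (m ^ 2 + 5 * m * d ^ 2 + 5 * d ^ 4) =
        (2 * c + d) ^ 4 + 10 * (2 * c + d) ^ 2 * d ^ 2 + 5 * d ^ 4 := by rw [← hcd]; ring
    have hQ3 : 16 * (m ^ 2 + 5 * m * d ^ 2 + 5 * d ^ 4) ≥ 5 * d ^ 4 := by
      rw [hQ2]; have : 0 ≤ (2 * c + d) ^ 4 + 10 * (2 * c + d) ^ 2 * d ^ 2 := by positivity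
      linarith
    have hlt : (d ^ 2).natAbs < e.natAbs := by
      rw [hed]
      generalize m ^ 2 + 5 * m * d ^ 2 + 5 * d ^ 4 = Q at hQ3
      zify
      rw [abs_mul, abs_mul, abs_pow]
      have hA : 5 ≤ |d| := Int.le_of_dvd (by positivity) ((dvd_abs _ _).2 hd5)
      have hd4 : d ^ 4 = |d| ^ 4 := by rw [← abs_pow, abs_of_nonneg (by positivity)]
      rw [hd4] at hQ3
      have hQ4 : Q ≤ |Q| := le_abs_self Q
      rw [abs_of_nonneg (by norm_num : (0 : ℤ) ≤ 5)]
      generalize |d| = D at *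
      generalize |Q| = Q' at *
      have h1 : D ^ 4 ≥ 125 * D := by
        have : D ^ 3 ≥ 5 ^ 3 := pow_le_pow_left₀ (by norm_num) hA 3
        nlinarith
      have h2 : D < 5 * Q' := by linarith
      nlinarith
    omega

lemma caseII {x y z : ℤ} (h : x ^ 5 + y ^ 5 = z ^ 5) (hxy : IsCoprime x y) (hz0 : z ≠ 0)
    (hz : (5 : ℤ) ∣ z) : False := by
  have h5 : Prime (5 : ℤ) := by norm_num
  have hs : (5 : ℤ) ∣ x + y := by
    apply h5.dvd_of_dvd_pow (n := 5)
    have : (x + y) ^ 5 = z ^ 5 + 5 * (x * y * (x + y) * ((x + y) ^ 2 - x * y)) := by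
      rw [← h]; ring
    rw [this]
    exact dvd_add (dvd_pow hz (by norm_num)) (dvd_mul_right _ _)
  obtain ⟨r, hr⟩ := hs
  obtain ⟨z', rfl⟩ := hz
  have hcop : IsCoprime (x * y) (x + y) := by
    apply IsCoprime.mul_left
    · rw [add_comm]; simpa using hxy.add_mul_left_right 1
    · simpa using hxy.symm.add_mul_left_right 1
  rw [hr] at hcop
  have hN : ¬ (5 : ℤ) ∣ -(x * y) := by
    rw [dvd_neg]
    exact (Prime.coprime_iff_not_dvd h5).1 hcop.of_mul_right_left.symm
  have hNr : IsCoprime (-(x * y)) r := hcop.of_mul_right_right.neg_left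
  have hN5 : IsCoprime (-(x * y)) 5 := hcop.of_mul_right_left.neg_left
  have hNe : IsCoprime (-(x * y)) (5 * r ^ 2) := hN5.mul_right hNr.pow_right
  obtain ⟨h1, h2⟩ := Qcop hN hNe
  obtain ⟨w, m, hw, hm⟩ := split (k := 3) (z := z') (d := r) (by
    have hy : y = 5 * r - x := by linarith
    have : (25 : ℤ) * (r * ((-(x * y)) ^ 2 + 5 * (-(x * y)) * (5 * r ^ 2) + 5 * (5 * r ^ 2) ^ 2)) =
      25 * (5 ^ 3 * z' ^ 5) := by
        have : (25 : ℤ) * (5 ^ 3 * z' ^ 5) = (5 * z') ^ 5 := by ring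
        rw [this, ← h, hy]; ring
    linarith) h1
    ((IsCoprime.pow_left_iff (by norm_num)).1 h2.of_mul_left_right)
  refine descent _ _ _ m (w ^ 2) 5 le_rfl ?_ ?_ hm hN hNe
  · have : r ≠ 0 := by
      rintro rfl
      apply hz0
      have hy : y = -x := by linarith
      have : (5 * z') ^ 5 = 0 := by rw [← h, hy]; ring
      exact pow_eq_zero_iff (by norm_num) |>.1 this
    positivity
  · rw [hw]; ring

lemma mod25 {x y z : ℤ} (h : x ^ 5 + y ^ 5 = z ^ 5) : (5 : ℤ) ∣ x ∨ (5 : ℤ) ∣ y ∨ (5 : ℤ) ∣ z := by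
  have key : ∀ t : ℤ, (5 : ℤ) ∣ t ∨ t ^ 5 % 25 = 1 ∨ t ^ 5 % 25 = 7 ∨ t ^ 5 % 25 = 18 ∨ t ^ 5 % 25 = 24 := by
    intro t
    obtain ⟨q, hq⟩ : ∃ q, t = 5 * q + t % 5 := ⟨t / 5, by omega⟩
    have hp : t ^ 5 % 25 = (t % 5) ^ 5 % 25 := by
      have : t ^ 5 = (t % 5) ^ 5 + 25 * (125 * q ^ 5 + 125 * q ^ 4 * (t % 5) + 50 * q ^ 3 * (t % 5) ^ 2
          + 10 * q ^ 2 * (t % 5) ^ 3 + q * (t % 5) ^ 4) := by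
        generalize t % 5 = r at hq
        rw [hq]; ring
      omega
    have h0 : 0 ≤ t % 5 := by omega
    have h1 : t % 5 < 5 := by omega
    rw [hp]
    rw [Int.dvd_iff_emod_eq_zero]
    generalize t % 5 = r at *
    interval_cases r <;> norm_num
  rcases key x with h1 | h1
  · exact Or.inl h1
  rcases key y with h2 | h2
  · exact Or.inr (Or.inl h2)
  rcases key z with h3 | h3
  · exact Or.inr (Or.inr h3)
  omega

lemma flt_int : FermatLastTheoremWith ℤ 5 := by
  apply fermatLastTheoremWith_of_fermatLastTheoremWith_coprime
  intro a b c ha hb hc hg h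
  have hF : a ^ 5 + b ^ 5 + (-c) ^ 5 = 0 := by rw [Odd.neg_pow (by decide), h]; ring
  have hp : ∀ p : ℤ, Prime p → p ∣ a → p ∣ b → p ∣ c → False := by
    intro p hp h1 h2 h3
    apply hp.not_dvd_one
    rw [← hg]
    apply Finset.dvd_gcd
    intro x hx
    simp only [Finset.mem_insert, Finset.mem_singleton] at hx
    rcases hx with rfl | rfl | rfl <;> assumption
  have hF2 : a ^ 5 + (-c) ^ 5 + b ^ 5 = 0 := by linarith
  have hF3 : b ^ 5 + (-c) ^ 5 + a ^ 5 = 0 := by linarith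
  have hab : IsCoprime a b := isCoprime_of_prime_dvd (fun h => ha h.1) fun p q h1 h2 =>
    hp p q h1 h2 (dvd_neg.1 (dvd_c_of_prime_of_dvd_a_of_dvd_b_of_FLT q h1 h2 hF))
  have hac : IsCoprime c (-a) := (isCoprime_of_prime_dvd (fun h => ha h.1) fun p q h1 h2 =>
    hp p q h1 (dvd_c_of_prime_of_dvd_a_of_dvd_b_of_FLT q h1 (dvd_neg.2 h2) hF2) h2 :
      IsCoprime a c).symm.neg_right
  have hbc : IsCoprime c (-b) := (isCoprime_of_prime_dvd (fun h => hb h.1) fun p q h1 h2 =>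
    hp p q (dvd_c_of_prime_of_dvd_a_of_dvd_b_of_FLT q h1 (dvd_neg.2 h2) hF3) h1 h2 :
      IsCoprime b c).symm.neg_right
  rcases mod25 h with h5 | h5 | h5
  · exact caseII (x := c) (y := -b) (z := a) (by rw [Odd.neg_pow (by decide), ← h]; ring) hbc ha h5
  · exact caseII (x := c) (y := -a) (z := b) (by rw [Odd.neg_pow (by decide), ← h]; ring) hac hb h5
  · exact caseII h hab hc h5

end FLT5

/-- The case `n = 5` of Fermat's Last Theorem. -/
theorem fermat_last_theorem_five :
    ∀ x y z : ℕ, 0 < x → 0 < y → 0 < z → x ^ 5 + y ^ 5 ≠ z ^ 5 := by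
  intro x y z hx hy hz
  exact fermatLastTheoremFor_iff_int.2 FLT5.flt_int x y z hx.ne' hy.ne' hz.ne'
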